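/- arXiv:math/0409347 — 7 statements merged into one kernel-verified Lean document; each statement's English description precedes it below -/
import Mathlib

section
/- Let X be a metric space and let φ : X → X be a surjective isometry such that dist(p, φ(p)) = α for every p ∈ X, where α > 0. Let p ∈ X and let γ : [0, α] → X be a geodesic segment with γ(0) = p and γ(α) = φ(p). Then for every t ∈ [0, α] one has dist(γ(t), φ(γ(t))) = α and dist(γ(t), φ(p)) + dist(φ(p), φ(γ(t))) = dist(γ(t), φ(γ(t))); in particular φ(p) lies on a geodesic from γ(t) to φ(γ(t)), so the concatenation of γ and φ∘γ is again a geodesic. -/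
/-- If `φ` is a surjective isometry of a metric space `X` with constant
displacement `α > 0` (a Clifford translation), and `γ : [0,α] → X` is a geodesic segment
from `p` to `φ p`, then for every `t ∈ [0,α]` we have `dist (γ t) (φ (γ t)) = α` and
`dist (γ t) (φ p) + dist (φ p) (φ (γ t)) = dist (γ t) (φ (γ t))`, so `φ p` lies on a
geodesic from `γ t` to `φ (γ t)`. -/
theorem stmt_0 {X : Type*} [MetricSpace X] (φ : X → X) (hφ : Isometry φ)
    (hsurj : Function.Surjective φ) (α : ℝ) (hα : 0 < α)
    (hdisp : ∀ p : X, dist p (φ p) = α)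
    (p : X) (γ : ℝ → X)
    (hγ : ∀ s ∈ Set.Icc (0:ℝ) α, ∀ t ∈ Set.Icc (0:ℝ) α, dist (γ s) (γ t) = |s - t|)
    (h0 : γ 0 = p) (hend : γ α = φ p) :
    ∀ t ∈ Set.Icc (0:ℝ) α,
      dist (γ t) (φ (γ t)) = α ∧
      dist (γ t) (φ p) + dist (φ p) (φ (γ t)) = dist (γ t) (φ (γ t)) := by
  intro t ht
  have hleft : dist (γ t) (φ p) = α - t := by
    rw [← hend, hγ t ht α ⟨hα.le, le_rfl⟩, abs_sub_comm, abs_of_nonneg (sub_nonneg.2 ht.2)]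
  have hright : dist (φ p) (φ (γ t)) = t := by
    rw [hφ.dist_eq, ← h0, hγ 0 ⟨le_rfl, hα.le⟩ t ht, zero_sub, abs_neg, abs_of_nonneg ht.1]
  refine ⟨hdisp _, ?_⟩
  rw [hleft, hright, hdisp, sub_add_cancel]
end

section
/- Let A and X be n×n complex matrices satisfying the algebraic Riccati equation X·X + X·A + Aᵀ·X = 0. Then the characteristic polynomials satisfy charpoly(−A − X) · charpoly(Aᵀ + X) = charpoly(−A) · charpoly(Aᵀ); consequently every eigenvalue of −A − X is an eigenvalue of −A or an eigenvalue of Aᵀ, i.e. spectrum(−A − X) ⊆ spectrum(−A) ∪ spectrum(Aᵀ). -/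
open Matrix

/-- If `X * X + X * A + B * X = 0`, then conjugating the block matrix with rows `(-A, -1)` and
`(0, B)` by the unipotent matrix with rows `(1, 0)` and `(X, 1)` shows that `-A - X` and `B + X`
together have the same characteristic polynomial as `-A` and `B` together. -/
theorem charpoly_mul_charpoly_of_riccati {ι R : Type*} [Fintype ι] [DecidableEq ι] [CommRing R]
    (A B X : Matrix ι ι R) (h : X * X + X * A + B * X = 0) :
    (-A - X).charpoly * (B + X).charpoly = (-A).charpoly * B.charpoly := by
  let P : (Matrix (ι ⊕ ι) (ι ⊕ ι) R)ˣ :=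
    ⟨fromBlocks 1 0 X 1, fromBlocks 1 0 (-X) 1, by simp [fromBlocks_multiply],
      by simp [fromBlocks_multiply]⟩
  have hconj : P⁻¹.val * fromBlocks (-A) (-1) 0 B * P.val
      = fromBlocks (-A - X) (-1) 0 (B + X) := by
    have hX : X * A + (B + X) * X = 0 := by rw [← h]; noncomm_ring
    change fromBlocks 1 0 (-X) 1 * fromBlocks (-A) (-1) 0 B * fromBlocks 1 0 X 1 = _
    simpa [fromBlocks_multiply, sub_eq_add_neg, add_comm X B] using hX
  rw [← charpoly_fromBlocks_zero₂₁, ← hconj, coe_units_inv, charpoly_units_conj',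
    charpoly_fromBlocks_zero₂₁]

/-- If complex matrices `A, X` satisfy the algebraic Riccati equation
`X·X + X·A + Aᵀ·X = 0`, then `charpoly (-A - X) * charpoly (Aᵀ + X)
  = charpoly (-A) * charpoly Aᵀ`; consequently every eigenvalue of `-A - X` is an
eigenvalue of `-A` or of `Aᵀ`. -/
theorem stmt_3 {n : ℕ} (A X : Matrix (Fin n) (Fin n) ℂ)
    (hric : X * X + X * A + Aᵀ * X = 0) :
    (-A - X).charpoly * (Aᵀ + X).charpoly = (-A).charpoly * Aᵀ.charpoly ∧
    spectrum ℂ (-A - X) ⊆ spectrum ℂ (-A) ∪ spectrum ℂ Aᵀ := by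
  have hchar := charpoly_mul_charpoly_of_riccati A Aᵀ X hric
  refine ⟨hchar, fun μ hμ => ?_⟩
  simp only [Set.mem_union, mem_spectrum_iff_isRoot_charpoly] at hμ ⊢
  rw [← Polynomial.root_mul, ← hchar, Polynomial.root_mul]
  exact Or.inl hμ
end

section
/- Let 𝔫 be a finite-dimensional real inner product space equipped with a Lie algebra structure, let D : 𝔫 → 𝔫 be a derivation of the Lie algebra which is self-adjoint with respect to the inner product, and let Z ∈ 𝔫 satisfy D(Z) = Z. Let j : 𝔫 → 𝔫 be a linear map satisfying ⟨j(V), W⟩ = ⟨[V, W], Z⟩ for all V, W ∈ 𝔫. Then j = j∘D + D∘j, and consequently j² commutes with D, i.e. j²∘D = D∘j². -/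
open scoped RealInnerProductSpace

/-- Let `𝔫` be a finite-dimensional real inner product space equipped with a
Lie algebra structure (bracket `B`, antisymmetric and satisfying the Jacobi identity),
let `D` be a self-adjoint derivation, and let `Z` satisfy `D Z = Z`. If `j` is linear with
`⟪j V, W⟫ = ⟪[V,W], Z⟫` for all `V, W`, then `j = j∘D + D∘j` and `j²` commutes with `D`. -/
theorem stmt_5 {𝔫 : Type*} [NormedAddCommGroup 𝔫] [InnerProductSpace ℝ 𝔫]
    [FiniteDimensional ℝ 𝔫]
    (B : 𝔫 →ₗ[ℝ] 𝔫 →ₗ[ℝ] 𝔫)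
    (hBanti : ∀ x y : 𝔫, B x y = - B y x)
    (hBjac : ∀ x y z : 𝔫, B (B x y) z + B (B y z) x + B (B z x) y = 0)
    (D : 𝔫 →ₗ[ℝ] 𝔫)
    (hder : ∀ x y : 𝔫, D (B x y) = B (D x) y + B x (D y))
    (hsa : ∀ x y : 𝔫, ⟪D x, y⟫ = ⟪x, D y⟫)
    (Z : 𝔫) (hZ : D Z = Z)
    (j : 𝔫 →ₗ[ℝ] 𝔫)
    (hj : ∀ V W : 𝔫, ⟪j V, W⟫ = ⟪B V W, Z⟫) :
    j = j ∘ₗ D + D ∘ₗ j ∧ (j ∘ₗ j) ∘ₗ D = D ∘ₗ (j ∘ₗ j) := by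
  have key : ∀ v, j v = j (D v) + D (j v) := fun v => by
    refine ext_inner_right ℝ fun w => ?_
    rw [inner_add_left, hsa, hj, hj, hj, ← inner_add_left, ← hder, hsa, hZ]
  refine ⟨LinearMap.ext key, LinearMap.ext fun v => ?_⟩
  have h₁ : j (j v) = j (j (D v)) + j (D (j v)) := by
    rw [← map_add, ← key]
  exact add_right_cancel (h₁.symm.trans ((key (j v)).trans (add_comm _ _)))
end

section
/- Let 𝔫 be a finite-dimensional real Lie algebra and let D : 𝔫 → 𝔫 be a derivation of 𝔫 such that 𝔫 is the direct sum of the eigenspaces of D and every eigenvalue of D is a positive real number. If λ is the largest eigenvalue of D, then the eigenspace of D for λ is contained in the center of 𝔫, i.e. every x with D(x) = λ·x satisfies [x, y] = 0 for all y ∈ 𝔫. -/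
/-- Let `𝔫` be a finite-dimensional real Lie algebra and `D` a derivation
such that `𝔫` is the (direct) sum of the eigenspaces of `D` and every eigenvalue of `D`
is positive. If `lam` is the largest eigenvalue, then the `lam`-eigenspace is contained
in the center of `𝔫`. -/
theorem stmt_8 {𝔫 : Type*} [LieRing 𝔫] [LieAlgebra ℝ 𝔫] [FiniteDimensional ℝ 𝔫]
    (D : Module.End ℝ 𝔫)
    (hder : ∀ x y : 𝔫, D ⁅x, y⁆ = ⁅D x, y⁆ + ⁅x, D y⁆)
    (hspan : (⨆ μ : ℝ, D.eigenspace μ) = ⊤)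
    (hpos : ∀ μ : ℝ, D.HasEigenvalue μ → 0 < μ)
    (lam : ℝ) (hlam : D.HasEigenvalue lam)
    (hmax : ∀ μ : ℝ, D.HasEigenvalue μ → μ ≤ lam) :
    ∀ x : 𝔫, D x = lam • x → ∀ y : 𝔫, ⁅x, y⁆ = 0 := by
  intro x hx y
  have hy : y ∈ ⨆ μ : ℝ, D.eigenspace μ := hspan ▸ Submodule.mem_top
  induction hy using Submodule.iSup_induction' with
  | zero => exact lie_zero x
  | add a b _ _ ha hb => rw [lie_add, ha, hb, add_zero]
  | mem μ a ha =>
    by_contra hne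
    have ha0 : a ≠ 0 := fun h => hne (by rw [h, lie_zero])
    have hμ : 0 < μ := hpos μ (Module.End.hasEigenvalue_of_hasEigenvector ⟨ha, ha0⟩)
    have hmem : ⁅x, a⁆ ∈ D.eigenspace (lam + μ) := by
      rw [Module.End.mem_eigenspace_iff] at ha ⊢
      rw [hder, hx, ha, smul_lie, lie_smul, add_smul]
    linarith [hmax _ (Module.End.hasEigenvalue_of_hasEigenvector ⟨hmem, hne⟩)]
end

section
/- Let V be a finite-dimensional real inner product space with dim V ≥ 2, let μ₁, …, μₙ : V → ℝ be finitely many linear functionals, and suppose there is a constant c such that ∑_{i=1}^{n} |μᵢ(A)| = c for every A ∈ V with ‖A‖ = 1. Then c = 0, and hence all μᵢ are zero. -/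
open scoped InnerProductSpace in
/-- If a finite sum of absolute values of linear functionals is a multiple of the norm, then a
functional in the sum vanishing at a unit vector `u` vanishes on the orthogonal complement of
`u`: otherwise the sum would have a kink at `u` in some direction where the norm is smooth. -/
theorem eq_zero_of_sum_abs_eq_mul_norm {V ι : Type*} [NormedAddCommGroup V]
    [InnerProductSpace ℝ V] [Fintype ι] {μ : ι → (V →ₗ[ℝ] ℝ)} {c : ℝ}
    (h : ∀ A : V, ∑ i, |μ i A| = c * ‖A‖) {i : ι} {u w : V} (hu : ‖u‖ = 1)
    (hi : μ i u = 0) (hw : ⟪u, w⟫_ℝ = 0) : μ i w = 0 := by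
  have hc : 0 ≤ c := by
    have h1 := h u
    rw [hu, mul_one] at h1
    exact h1 ▸ Finset.sum_nonneg fun _ _ => abs_nonneg _
  have norm_le (t : ℝ) : ‖u + t • w‖ ≤ 1 + t ^ 2 * ‖w‖ ^ 2 / 2 := by
    have h1 : ‖u + t • w‖ ^ 2 = 1 + t ^ 2 * ‖w‖ ^ 2 := by
      rw [norm_add_sq_real, inner_smul_right, hw, hu, norm_smul, mul_pow, Real.norm_eq_abs,
        sq_abs]
      ring
    nlinarith [sq_nonneg (‖u + t • w‖ - 1)]
  have kink (t : ℝ) : 2 * |t * μ i w| ≤ c * (t ^ 2 * ‖w‖ ^ 2) := by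
    have h1 : 2 * |t * μ i w| ≤
        ∑ j, (|μ j (u + t • w)| + |μ j (u + (-t) • w)| - 2 * |μ j u|) := by
      refine le_trans (le_of_eq ?_) (Finset.single_le_sum (fun j _ => ?_) (Finset.mem_univ i))
      · simp [hi, two_mul]
      · have h2 := abs_add_le (μ j (u + t • w)) (μ j (u + (-t) • w))
        have h3 : μ j (u + t • w) + μ j (u + (-t) • w) = 2 * μ j u := by
          simp only [map_add, map_smul, smul_eq_mul]
          ring
        rw [h3, abs_mul, abs_two] at h2
        linarith
    rw [Finset.sum_sub_distrib, Finset.sum_add_distrib, ← Finset.mul_sum, h, h, h, hu] at h1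
    have h2 := mul_le_mul_of_nonneg_left (norm_le t) hc
    have h3 := mul_le_mul_of_nonneg_left (norm_le (-t)) hc
    rw [neg_sq] at h3
    linarith
  by_contra hne
  have hm : 0 < |μ i w| := abs_pos.mpr hne
  have hK : 0 ≤ c * ‖w‖ ^ 2 := by positivity
  have ht : 0 < |μ i w| / (c * ‖w‖ ^ 2 + 1) := by positivity
  have h1 := kink (|μ i w| / (c * ‖w‖ ^ 2 + 1))
  rw [abs_mul, abs_of_pos ht] at h1
  have h2 : |μ i w| / (c * ‖w‖ ^ 2 + 1) * (c * ‖w‖ ^ 2 + 1) = |μ i w| :=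
    div_mul_cancel₀ _ (by positivity)
  have h3 : 2 * |μ i w| ≤ |μ i w| / (c * ‖w‖ ^ 2 + 1) * (c * ‖w‖ ^ 2) :=
    le_of_mul_le_mul_left (by linarith) ht
  linarith

/-- On a finite-dimensional real inner product space of dimension `≥ 2`,
if finitely many linear functionals `μᵢ` satisfy `∑ i, |μᵢ A| = c` for every unit
vector `A`, then `c = 0` and all `μᵢ` are zero. -/
theorem stmt_10 {V : Type*} [NormedAddCommGroup V] [InnerProductSpace ℝ V]
    [FiniteDimensional ℝ V] (hdim : 2 ≤ Module.finrank ℝ V)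
    (n : ℕ) (μ : Fin n → (V →ₗ[ℝ] ℝ)) (c : ℝ)
    (hc : ∀ A : V, ‖A‖ = 1 → ∑ i, |μ i A| = c) :
    c = 0 ∧ ∀ i, μ i = 0 := by
  have hnorm (A : V) : ∑ i, |μ i A| = c * ‖A‖ := by
    rcases eq_or_ne A 0 with rfl | hA
    · simp
    · have hpos : 0 < ‖A‖ := norm_pos_iff.mpr hA
      rw [← hc (‖A‖⁻¹ • A) (norm_smul_inv_norm hA), Finset.sum_mul]
      refine Finset.sum_congr rfl fun i _ => ?_
      rw [map_smul, smul_eq_mul, abs_mul, abs_of_pos (inv_pos.mpr hpos)]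
      field_simp
  have hzero (i : Fin n) : μ i = 0 := by
    have hker : LinearMap.ker (μ i) ≠ ⊥ :=
      LinearMap.ker_ne_bot_of_finrank_lt (by rw [Module.finrank_self]; omega)
    obtain ⟨v, hv, hv0⟩ := Submodule.exists_mem_ne_zero_of_ne_bot hker
    have hu : ‖‖v‖⁻¹ • v‖ = 1 := norm_smul_inv_norm hv0
    have hiu : μ i (‖v‖⁻¹ • v) = 0 := by
      rw [map_smul, LinearMap.mem_ker.mp hv, smul_zero]
    generalize ‖v‖⁻¹ • v = u at hu hiu
    ext w
    have horth : inner ℝ u (w - inner ℝ u w • u) = 0 := by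
      rw [inner_sub_right, inner_smul_right, real_inner_self_eq_norm_sq, hu]
      ring
    simpa [hiu] using eq_zero_of_sum_abs_eq_mul_norm hnorm hu hiu horth
  refine ⟨?_, hzero⟩
  have : Nontrivial V := Module.nontrivial_of_finrank_pos (R := ℝ) (by omega)
  obtain ⟨u, hu⟩ := exists_norm_eq V zero_le_one
  simp [← hc u hu, hzero]
end

section
/- Let μ ∈ ℝ and let u : ℝ → ℝ be twice differentiable on (0,1) and satisfy z(1−z)·u''(z) + ((1+μ) − 2z)·u'(z) − μ(1−μ)·u(z) = 0 for all z ∈ (0,1). Define h : ℝ → ℝ by h(t) = e^{−μt}·u((1 − tanh t)/2). Then h is twice differentiable and satisfies h''(t) = ((μ + μ²·sinh²(t))/cosh²(t))·h(t) for all t ∈ ℝ. -/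
theorem hasDerivAt_tanh_one_sub_sq (t : ℝ) :
    HasDerivAt Real.tanh (1 - Real.tanh t ^ 2) t := by
  have hc : Real.cosh t ≠ 0 := (Real.cosh_pos t).ne'
  have hq := (Real.hasDerivAt_sinh t).div (Real.hasDerivAt_cosh t) hc
  have he : Real.tanh = Real.sinh / Real.cosh :=
    funext fun x => Real.tanh_eq_sinh_div_cosh x
  rw [Real.tanh_eq_sinh_div_cosh, he]
  refine hq.congr_deriv ?_
  field_simp

theorem hasDerivAt_one_sub_tanh_div_two (t : ℝ) :
    HasDerivAt (fun s => (1 - Real.tanh s) / 2) (-(1 - Real.tanh t ^ 2) / 2) t :=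
  ((hasDerivAt_tanh_one_sub_sq t).const_sub 1).div_const 2

theorem one_sub_tanh_div_two_mem_Ioo (t : ℝ) :
    (1 - Real.tanh t) / 2 ∈ Set.Ioo (0 : ℝ) 1 :=
  ⟨by linarith [Real.tanh_lt_one t], by linarith [Real.neg_one_lt_tanh t]⟩

theorem add_sq_mul_sinh_sq_div_cosh_sq (μ t : ℝ) :
    (μ + μ ^ 2 * Real.sinh t ^ 2) / Real.cosh t ^ 2 =
      μ * (1 - Real.tanh t ^ 2) + μ ^ 2 * Real.tanh t ^ 2 := by
  have hc : Real.cosh t ≠ 0 := (Real.cosh_pos t).ne'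
  rw [Real.tanh_eq_sinh_div_cosh]
  field_simp
  rw [Real.cosh_sq]
  ring


/-- If `u` solves the hypergeometric equation
`z(1-z)u'' + ((1+μ) - 2z)u' - μ(1-μ)u = 0` on `(0,1)`, then
`h(t) = e^{-μt}·u((1 - tanh t)/2)` is twice differentiable on `ℝ` and satisfies
`h''(t) = ((μ + μ²·sinh²t)/cosh²t)·h(t)`. -/
theorem stmt_12 (μ : ℝ) (u u' u'' : ℝ → ℝ)
    (hu : ∀ z ∈ Set.Ioo (0:ℝ) 1, HasDerivAt u (u' z) z)
    (hu' : ∀ z ∈ Set.Ioo (0:ℝ) 1, HasDerivAt u' (u'' z) z)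
    (hode : ∀ z ∈ Set.Ioo (0:ℝ) 1,
      z * (1 - z) * u'' z + ((1 + μ) - 2 * z) * u' z - μ * (1 - μ) * u z = 0)
    (h : ℝ → ℝ)
    (hh : ∀ t : ℝ, h t = Real.exp (-μ * t) * u ((1 - Real.tanh t) / 2)) :
    ∃ h' : ℝ → ℝ,
      (∀ t : ℝ, HasDerivAt h (h' t) t) ∧
      ∀ t : ℝ, HasDerivAt h'
        (((μ + μ ^ 2 * Real.sinh t ^ 2) / Real.cosh t ^ 2) * h t) t := by
  have hexp (t : ℝ) :
      HasDerivAt (fun s => Real.exp (-μ * s)) (Real.exp (-μ * t) * (-μ)) t := by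
    simpa using ((hasDerivAt_id t).const_mul (-μ)).exp
  have hucomp (t : ℝ) := (hu _ (one_sub_tanh_div_two_mem_Ioo t)).comp t
    (hasDerivAt_one_sub_tanh_div_two t)
  have hucomp' (t : ℝ) := (hu' _ (one_sub_tanh_div_two_mem_Ioo t)).comp t
    (hasDerivAt_one_sub_tanh_div_two t)
  refine ⟨fun t => Real.exp (-μ * t) * (-μ * u ((1 - Real.tanh t) / 2) +
    -(1 - Real.tanh t ^ 2) / 2 * u' ((1 - Real.tanh t) / 2)), fun t => ?_, fun t => ?_⟩
  · rw [funext hh]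
    refine ((hexp t).mul (hucomp t)).congr_deriv ?_
    simp only [Function.comp_apply]
    ring
  · have hS : HasDerivAt (fun s => -(1 - Real.tanh s ^ 2) / 2)
        (Real.tanh t * (1 - Real.tanh t ^ 2)) t :=
      ((((hasDerivAt_tanh_one_sub_sq t).pow 2).const_sub 1).neg.div_const 2).congr_deriv
        (by push_cast; ring)
    refine ((hexp t).mul
      (((hucomp t).const_mul (-μ)).add (hS.mul (hucomp' t)))).congr_deriv ?_
    have ode := hode _ (one_sub_tanh_div_two_mem_Ioo t)
    rw [add_sq_mul_sinh_sq_div_cosh_sq, hh]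
    simp only [Function.comp_apply, Pi.add_apply, Pi.mul_apply]
    linear_combination Real.exp (-μ * t) * (1 - Real.tanh t ^ 2) * ode
end

section
/- Let ρ, θ ∈ ℝ and let u : ℝ → ℝ be twice differentiable on (0,1) and satisfy z(1−z)·u''(z) + ρ(1−2z)·u'(z) + θ²·u(z) = 0 for all z ∈ (0,1). Define z(t) = (1 − tanh t)/2, f(t) = −(cosh t)^{−ρ}·u'(z(t)) and g(t) = 2θ·(cosh t)^{1−ρ}·u(z(t)). Then for all t ∈ ℝ: f'(t) = ρ·tanh(t)·f(t) − (θ/cosh t)·g(t) and g'(t) = (θ/cosh t)·f(t) + (1−ρ)·tanh(t)·g(t). -/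
theorem Real.hasDerivAt_tanh_inv_cosh_sq (t : ℝ) :
    HasDerivAt Real.tanh (1 / Real.cosh t ^ 2) t := by
  have hc := (Real.cosh_pos t).ne'
  have h := (Real.hasDerivAt_sinh t).div (Real.hasDerivAt_cosh t) hc
  have e : Real.tanh = Real.sinh / Real.cosh := funext fun x => Real.tanh_eq_sinh_div_cosh x
  rw [e]
  refine h.congr_deriv ?_
  rw [← Real.cosh_sq_sub_sinh_sq t]
  ring

theorem Real.hasDerivAt_cosh_rpow (p t : ℝ) :
    HasDerivAt (fun x => Real.cosh x ^ p) (p * Real.tanh t * Real.cosh t ^ p) t := by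
  have hc := Real.cosh_pos t
  refine ((Real.hasDerivAt_cosh t).rpow_const (p := p) (Or.inl hc.ne')).congr_deriv ?_
  rw [Real.rpow_sub_one hc.ne', Real.tanh_eq_sinh_div_cosh]
  ring

theorem Real.half_one_sub_tanh_mul_one_sub (t : ℝ) :
    (1 - Real.tanh t) / 2 * (1 - (1 - Real.tanh t) / 2) = 1 / (4 * Real.cosh t ^ 2) := by
  have hc := (Real.cosh_pos t).ne'
  have h := Real.cosh_sq_sub_sinh_sq t
  rw [Real.tanh_eq_sinh_div_cosh]
  field_simp
  linear_combination 4 * h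


/-- If `u` solves `z(1-z)u'' + ρ(1-2z)u' + θ²u = 0` on `(0,1)`, and
`z(t) = (1 - tanh t)/2`, `f(t) = -(cosh t)^{-ρ}·u'(z(t))`,
`g(t) = 2θ·(cosh t)^{1-ρ}·u(z(t))`, then
`f' = ρ·tanh·f - (θ/cosh)·g` and `g' = (θ/cosh)·f + (1-ρ)·tanh·g` on `ℝ`. -/
theorem stmt_13 (ρ θ : ℝ) (u u' u'' : ℝ → ℝ)
    (hu : ∀ z ∈ Set.Ioo (0:ℝ) 1, HasDerivAt u (u' z) z)
    (hu' : ∀ z ∈ Set.Ioo (0:ℝ) 1, HasDerivAt u' (u'' z) z)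
    (hode : ∀ z ∈ Set.Ioo (0:ℝ) 1,
      z * (1 - z) * u'' z + ρ * (1 - 2 * z) * u' z + θ ^ 2 * u z = 0)
    (f g : ℝ → ℝ)
    (hf : ∀ t : ℝ, f t = -(Real.cosh t ^ (-ρ)) * u' ((1 - Real.tanh t) / 2))
    (hg : ∀ t : ℝ, g t = 2 * θ * (Real.cosh t ^ (1 - ρ)) * u ((1 - Real.tanh t) / 2)) :
    ∀ t : ℝ,
      HasDerivAt f (ρ * Real.tanh t * f t - (θ / Real.cosh t) * g t) t ∧
      HasDerivAt g ((θ / Real.cosh t) * f t + (1 - ρ) * Real.tanh t * g t) t := by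
  intro t
  have hc := Real.cosh_pos t
  have hz : (1 - Real.tanh t) / 2 ∈ Set.Ioo (0 : ℝ) 1 := by
    constructor <;> linarith [Real.tanh_lt_one t, Real.neg_one_lt_tanh t]
  have hz' := ((Real.hasDerivAt_tanh_inv_cosh_sq t).const_sub 1).div_const 2
  have hode_t := hode _ hz
  rw [Real.half_one_sub_tanh_mul_one_sub] at hode_t
  have hpow : Real.cosh t ^ (1 - ρ) = Real.cosh t * Real.cosh t ^ (-ρ) := by
    rw [sub_eq_add_neg, Real.rpow_add hc, Real.rpow_one]
  have hF := (Real.hasDerivAt_cosh_rpow (-ρ) t).neg.mul ((hu' _ hz).comp t hz')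
  have hG := ((Real.hasDerivAt_cosh_rpow (1 - ρ) t).const_mul (2 * θ)).mul
    ((hu _ hz).comp t hz')
  rw [hf t, hg t, funext hf, funext hg]
  constructor
  · refine hF.congr_deriv ?_
    simp only [Function.comp_apply, Pi.neg_apply, hpow]
    field_simp at hode_t ⊢
    linear_combination hode_t
  · refine hG.congr_deriv ?_
    simp only [Function.comp_apply, hpow]
    field_simp
    ring
end
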